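/- arXiv:nlin/0508007 — 5 statements merged into one kernel-verified Lean document; each statement's English description precedes it below -/
import Mathlib

section
/- Let N ≥ 1, let λ_0, …, λ_{N−1} be distinct complex numbers (so that the conjugates λ_0^*, …, λ_{N−1}^* are also distinct), and let γ_0, …, γ_{N−1} be nonzero complex numbers and F_0, …, F_{N−1} complex numbers. Suppose A is a complex polynomial of degree at most N−1 and C is a monic complex polynomial of degree N satisfying, for every k = 0, …, N−1, the relations A(λ_k) F_k = γ_k C(λ_k) and C(λ_k^*) F_k^* = −γ_k^* A(λ_k^*), where ^* denotes complex conjugation. Define G_k := F_k/γ_k, p_{kj} := ∏_{m≠j} (λ_k − λ_m^*)/(λ_j^* − λ_m^*), w_{km} := G_k^* ∑_{n=0}^{N−1} G_n p_{nm} p_{kn}^*, and φ_k := −G_k^* ∏_{j=0}^{N−1} (λ_k^* − λ_j). Then for every k = 0, …, N−1, A(λ_k^*) + ∑_{m=0}^{N−1} w_{km} A(λ_m^*) = φ_k. -/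
open Finset Polynomial Complex

/-- Lagrange interpolation formula, with the basis polynomials written as explicit products. -/
theorem eval_eq_sum_eval_mul_prod_div {K ι : Type*} [Field K] [Fintype ι] [DecidableEq ι]
    {v : ι → K} (hv : Function.Injective v) {P : Polynomial K}
    (hP : P.degree < Fintype.card ι) (x : K) :
    P.eval x = ∑ n, P.eval (v n) * ∏ m ∈ Finset.univ.erase n, (x - v m) / (v n - v m) := by
  conv_lhs => rw [Lagrange.eq_interpolate (s := Finset.univ) hv.injOn (f := P) (by simpa using hP)]
  simp only [Lagrange.interpolate_apply, eval_finsetSum, eval_mul, eval_C, Lagrange.basis,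
    eval_prod, Lagrange.basisDivisor, eval_sub, eval_X]
  refine Finset.sum_congr rfl fun n _ => congrArg _ (Finset.prod_congr rfl fun m _ => ?_)
  rw [div_eq_inv_mul]

/-- Interpolation of a monic polynomial at as many nodes as its degree. -/
theorem Polynomial.Monic.eval_eq_prod_add_sum {K ι : Type*} [Field K] [Fintype ι] [DecidableEq ι]
    {v : ι → K} (hv : Function.Injective v) {P : Polynomial K} (hP : P.Monic)
    (hdeg : P.natDegree = Fintype.card ι) (x : K) :
    P.eval x = ∏ j, (x - v j) +
      ∑ n, P.eval (v n) * ∏ m ∈ Finset.univ.erase n, (x - v m) / (v n - v m) := by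
  have hPdeg : P.degree = Fintype.card ι := by
    rw [degree_eq_natDegree hP.ne_zero, hdeg]
  have hlt : (P - Lagrange.nodal Finset.univ v).degree < Fintype.card ι := by
    rw [← hPdeg]
    exact degree_sub_lt_left (by rw [hPdeg, Lagrange.degree_nodal, Finset.card_univ]) hP.ne_zero
      (by rw [hP.leadingCoeff, Lagrange.nodal_monic.leadingCoeff])
  have h := eval_eq_sum_eval_mul_prod_div hv hlt x
  simp only [eval_sub, Lagrange.eval_nodal_at_node (Finset.mem_univ _), sub_zero,
    Lagrange.eval_nodal] at h
  rw [← h]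
  ring

/-- **Reduction of the inverse-scattering system to an `N × N` linear system.**
Given distinct eigenvalues `μ k`, nonzero proportionality constants `γ k`, and data `F k`,
suppose the polynomial `A` (degree at most `N−1`) and the monic polynomial `C` (degree `N`)
satisfy `A(μₖ)Fₖ = γₖ C(μₖ)` and `C(μₖ*)Fₖ* = −γₖ* A(μₖ*)` for all `k`.  With
`Gₖ := Fₖ/γₖ`, `p k j := ∏_{m≠j} (μₖ − μₘ*)/(μⱼ* − μₘ*)`,
`w k m := Gₖ* ∑ₙ Gₙ p n m (p k n)*` and `φₖ := −Gₖ* ∏ⱼ (μₖ* − μⱼ)`, the values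
`A(μₖ*)` satisfy the linear system `A(μₖ*) + ∑ₘ w k m · A(μₘ*) = φₖ`. -/
theorem nsoliton_linear_system (N : ℕ) (hN : 1 ≤ N) (μ : Fin N → ℂ)
    (hμ : Function.Injective μ) (γ F : Fin N → ℂ) (hγ : ∀ k, γ k ≠ 0)
    (A C : Polynomial ℂ) (hA : A.natDegree ≤ N - 1)
    (hCmonic : C.Monic) (hCdeg : C.natDegree = N)
    (hrel1 : ∀ k : Fin N, A.eval (μ k) * F k = γ k * C.eval (μ k))
    (hrel2 : ∀ k : Fin N,
      C.eval (starRingEnd ℂ (μ k)) * starRingEnd ℂ (F k)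
        = -(starRingEnd ℂ (γ k)) * A.eval (starRingEnd ℂ (μ k)))
    (G : Fin N → ℂ) (hG : ∀ k, G k = F k / γ k)
    (p : Fin N → Fin N → ℂ)
    (hp : ∀ k j, p k j = ∏ m ∈ Finset.univ.erase j,
      (μ k - starRingEnd ℂ (μ m)) / (starRingEnd ℂ (μ j) - starRingEnd ℂ (μ m)))
    (w : Fin N → Fin N → ℂ)
    (hw : ∀ k m, w k m = starRingEnd ℂ (G k) * ∑ n : Fin N, G n * p n m * starRingEnd ℂ (p k n))
    (φ : Fin N → ℂ)
    (hφ : ∀ k, φ k = -(starRingEnd ℂ (G k)) * ∏ j : Fin N, (starRingEnd ℂ (μ k) - μ j)) :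
    ∀ k : Fin N,
      A.eval (starRingEnd ℂ (μ k)) + ∑ m : Fin N, w k m * A.eval (starRingEnd ℂ (μ m)) = φ k := by
  intro k
  have hμ' : Function.Injective fun j => starRingEnd ℂ (μ j) :=
    (starRingEnd ℂ).injective.comp hμ
  have hAdeg : A.degree < Fintype.card (Fin N) := by
    rw [Fintype.card_fin]
    exact lt_of_le_of_lt degree_le_natDegree (by exact_mod_cast (by omega : A.natDegree < N))
  have hAn : ∀ n, A.eval (μ n) = ∑ m, A.eval (starRingEnd ℂ (μ m)) * p n m := fun n => by
    simp only [hp]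
    exact eval_eq_sum_eval_mul_prod_div hμ' hAdeg (μ n)
  have hCn : ∀ n, C.eval (μ n) = G n * A.eval (μ n) := fun n => by
    rw [hG, div_mul_eq_mul_div, eq_div_iff (hγ n)]
    linear_combination -hrel1 n
  have hCk : C.eval (starRingEnd ℂ (μ k)) = ∏ j, (starRingEnd ℂ (μ k) - μ j) +
      ∑ n, C.eval (μ n) * starRingEnd ℂ (p k n) := by
    simp only [hp, map_prod, map_div₀, map_sub, Complex.conj_conj]
    exact hCmonic.eval_eq_prod_add_sum hμ (by simpa using hCdeg) _
  have hAk : A.eval (starRingEnd ℂ (μ k)) =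
      -(starRingEnd ℂ (G k) * C.eval (starRingEnd ℂ (μ k))) := by
    have hγk : starRingEnd ℂ (γ k) ≠ 0 := (_root_.map_ne_zero _).2 (hγ k)
    rw [hG, map_div₀, div_mul_eq_mul_div, eq_neg_iff_add_eq_zero]
    field_simp
    linear_combination hrel2 k
  have hsum : ∑ m, w k m * A.eval (starRingEnd ℂ (μ m)) =
      starRingEnd ℂ (G k) * ∑ n, C.eval (μ n) * starRingEnd ℂ (p k n) := by
    simp only [hw, hCn, hAn, Finset.mul_sum, Finset.sum_mul]
    rw [Finset.sum_comm]
    refine Finset.sum_congr rfl fun n _ => Finset.sum_congr rfl fun m _ => ?_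
    ring
  rw [hsum, hφ, hAk, hCk]
  ring
end

section
/- Fix A > 0 and an integer N ≥ 1, and set ℏ_N := A/N, λ_{N,k} := i(A − (k + 1/2)ℏ_N) and γ_{N,k} := (−1)^{k+1} for k = 0, …, N−1. Fix x, t ∈ ℝ and define Q(λ) := λx + λ²t, θ⁰(λ) := iπλ + πA, P_N(λ) := ∏_{n=0}^{N−1} (λ − λ_{N,n}^*)/(λ − λ_{N,n}), c⁰_{N,k} := (1/γ_{N,k}) · ∏_{n=0}^{N−1}(λ_{N,k} − λ_{N,n}^*) / ∏_{n≠k}(λ_{N,k} − λ_{N,n}), and c_{N,k}(x,t) := c⁰_{N,k} · exp(2iQ(λ_{N,k})/ℏ_N). Then for every integer j and every k ∈ {0, …, N−1}, the function λ ↦ (λ − λ_{N,k}) · P_N(λ) · exp((2iQ(λ) − (2j+1)·iθ⁰(λ))/ℏ_N) tends to (−1)^j · i · c_{N,k}(x,t) as λ → λ_{N,k} with λ ≠ λ_{N,k}. -/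
open Finset Filter Topology

namespace NSoliton

/-- The semiclassical parameter `ℏ_N = A/N`. -/
noncomputable def hbar (A : ℝ) (N : ℕ) : ℝ := A / N

/-- The soliton eigenvalues `λ_{N,k} = i(A − (k + 1/2)ℏ_N)`. -/
noncomputable def lam (A : ℝ) (N k : ℕ) : ℂ :=
  Complex.I * ((A : ℂ) - ((k : ℂ) + 1/2) * (hbar A N : ℂ))

/-- The phase `Q(λ) = λx + λ²t`. -/
noncomputable def Q (x t : ℝ) (z : ℂ) : ℂ := z * (x : ℂ) + z ^ 2 * (t : ℂ)

/-- The interpolation phase `θ⁰(λ) = iπλ + πA`. -/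
noncomputable def theta0 (A : ℝ) (z : ℂ) : ℂ :=
  Complex.I * (Real.pi : ℂ) * z + (Real.pi : ℂ) * (A : ℂ)

/-- The Blaschke-type product `P_N(λ) = ∏ₙ (λ − λ_{N,n}*)/(λ − λ_{N,n})`. -/
noncomputable def P (A : ℝ) (N : ℕ) (z : ℂ) : ℂ :=
  ∏ n ∈ Finset.range N, (z - starRingEnd ℂ (lam A N n)) / (z - lam A N n)

/-- The constants `c⁰_{N,k} = (1/γ_{N,k}) ∏ₙ(λ_{N,k} − λ_{N,n}*) / ∏_{n≠k}(λ_{N,k} − λ_{N,n})`,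
with `γ_{N,k} = (−1)^{k+1}`. -/
noncomputable def c0 (A : ℝ) (N k : ℕ) : ℂ :=
  (1 / (-1 : ℂ) ^ (k + 1)) *
    (∏ n ∈ Finset.range N, (lam A N k - starRingEnd ℂ (lam A N n))) /
      (∏ n ∈ (Finset.range N).erase k, (lam A N k - lam A N n))

/-- The connection coefficients `c_{N,k}(x,t) = c⁰_{N,k} · exp(2iQ(λ_{N,k})/ℏ_N)`. -/
noncomputable def cConn (A : ℝ) (N k : ℕ) (x t : ℝ) : ℂ :=
  c0 A N k * Complex.exp (2 * Complex.I * Q x t (lam A N k) / (hbar A N : ℂ))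

end NSoliton

namespace NSoliton

lemma hbar_ne_zero {A : ℝ} (hA : 0 < A) {N : ℕ} (hN : 1 ≤ N) : (hbar A N : ℂ) ≠ 0 := by
  have hN' : (0 : ℝ) < N := by exact_mod_cast hN
  exact_mod_cast (div_pos hA hN').ne'

lemma lam_injective {A : ℝ} (hA : 0 < A) {N : ℕ} (hN : 1 ≤ N) :
    Function.Injective (lam A N) := by
  intro m n h
  have h₁ := mul_left_cancel₀ Complex.I_ne_zero h
  have h₂ := mul_right_cancel₀ (hbar_ne_zero hA hN) (sub_right_injective h₁)
  exact_mod_cast add_right_cancel h₂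

lemma theta0_lam (A : ℝ) (N k : ℕ) :
    theta0 A (lam A N k) = Real.pi * ((k : ℂ) + 1 / 2) * hbar A N := by
  unfold theta0 lam
  linear_combination (Real.pi : ℂ) * (A - ((k : ℂ) + 1 / 2) * hbar A N) * Complex.I_mul_I

/-- The odd powers of `exp (-iπ(k + 1/2))`. -/
lemma exp_neg_odd_mul (j : ℤ) (k : ℕ) :
    Complex.exp (-((2 * (j : ℂ) + 1) * Complex.I * (Real.pi * ((k : ℂ) + 1 / 2)))) =
      (-1 : ℂ) ^ j * (-1) ^ (k + 1) * Complex.I := by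
  have hne : (-1 : ℂ) ≠ 0 := by norm_num
  have harg : -((2 * (j : ℂ) + 1) * Complex.I * (Real.pi * ((k : ℂ) + 1 / 2))) =
      ((j + ((k + 1 : ℕ) : ℤ) + 2 * -(j * k + j + k + 1) : ℤ) : ℂ) * (Real.pi * Complex.I) +
        Real.pi / 2 * Complex.I := by
    push_cast
    ring
  rw [harg, Complex.exp_add, Complex.exp_int_mul, Complex.exp_pi_mul_I,
    Complex.exp_pi_div_two_mul_I, zpow_add₀ hne, zpow_add₀ hne, zpow_mul, zpow_natCast]
  norm_num

/-- Away from the pole, `(λ − λ_{N,k}) P_N(λ)` is `P_N` with the factor `λ − λ_{N,k}` removed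
from its denominator. -/
lemma sub_mul_P {A : ℝ} {N k : ℕ} (hk : k < N) {z : ℂ} (hz : z ≠ lam A N k) :
    (z - lam A N k) * P A N z =
      (∏ n ∈ range N, (z - starRingEnd ℂ (lam A N n))) /
        ∏ n ∈ (range N).erase k, (z - lam A N n) := by
  rw [P, prod_div_distrib, ← mul_prod_erase (range N) (fun n => z - lam A N n)
    (mem_range.mpr hk), mul_div_assoc', mul_div_mul_left _ _ (sub_ne_zero.mpr hz)]

end NSoliton

open NSoliton in
/-- **Residue of the interpolants at the soliton eigenvalues.**  For every integer `j` and
every `k < N`, the function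
`λ ↦ (λ − λ_{N,k}) · P_N(λ) · exp((2iQ(λ) − (2j+1)iθ⁰(λ))/ℏ_N)` tends to
`(−1)^j · i · c_{N,k}(x,t)` as `λ → λ_{N,k}`, `λ ≠ λ_{N,k}`. -/
theorem residue_of_interpolant (A : ℝ) (hA : 0 < A) (N : ℕ) (hN : 1 ≤ N) (x t : ℝ)
    (j : ℤ) (k : ℕ) (hk : k < N) :
    Tendsto
      (fun z : ℂ => (z - lam A N k) * P A N z *
        Complex.exp ((2 * Complex.I * Q x t z - (2 * (j : ℂ) + 1) * Complex.I * theta0 A z)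
          / (hbar A N : ℂ)))
      (𝓝[≠] (lam A N k))
      (𝓝 ((-1 : ℂ) ^ j * Complex.I * cConn A N k x t)) := by
  have hh := hbar_ne_zero hA hN
  have hden : ∏ n ∈ (range N).erase k, (lam A N k - lam A N n) ≠ 0 :=
    prod_ne_zero_iff.mpr fun n hn =>
      sub_ne_zero.mpr fun h => (mem_erase.mp hn).1 (lam_injective hA hN h).symm
  have hexp : Complex.exp ((2 * Complex.I * Q x t (lam A N k) -
        (2 * (j : ℂ) + 1) * Complex.I * theta0 A (lam A N k)) / (hbar A N : ℂ)) =
      Complex.exp (2 * Complex.I * Q x t (lam A N k) / (hbar A N : ℂ)) *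
        ((-1 : ℂ) ^ j * (-1) ^ (k + 1) * Complex.I) := by
    rw [← exp_neg_odd_mul, ← Complex.exp_add, theta0_lam]
    congr 1
    field_simp
    ring
  have hval : (-1 : ℂ) ^ j * Complex.I * cConn A N k x t =
      (∏ n ∈ range N, (lam A N k - starRingEnd ℂ (lam A N n))) /
        (∏ n ∈ (range N).erase k, (lam A N k - lam A N n)) *
      Complex.exp ((2 * Complex.I * Q x t (lam A N k) -
        (2 * (j : ℂ) + 1) * Complex.I * theta0 A (lam A N k)) / (hbar A N : ℂ)) := by
    have hsign : 1 / (-1 : ℂ) ^ (k + 1) = (-1) ^ (k + 1) := by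
      rw [one_div, ← inv_pow, inv_neg_one]
    rw [hexp, cConn, c0, hsign]
    ring
  have hcont : ContinuousAt (fun z : ℂ =>
      (∏ n ∈ range N, (z - starRingEnd ℂ (lam A N n))) /
        (∏ n ∈ (range N).erase k, (z - lam A N n)) *
      Complex.exp ((2 * Complex.I * Q x t z -
        (2 * (j : ℂ) + 1) * Complex.I * theta0 A z) / (hbar A N : ℂ))) (lam A N k) := by
    refine ContinuousAt.mul (ContinuousAt.div ?_ ?_ hden) ?_
    · fun_prop
    · fun_prop
    · unfold Q theta0
      fun_prop
  rw [hval]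
  refine (hcont.tendsto.mono_left nhdsWithin_le_nhds).congr' ?_
  filter_upwards [self_mem_nhdsWithin] with z hz
  rw [sub_mul_P hk hz]
end

section
/- Let ℏ > 0, let σ₃ := diag(1, −1) ∈ M₂(ℂ), and write [X,Y] := XY − YX. Let m₁, m₂ : ℝ × ℝ → M₂(ℂ) be matrix-valued functions of (x,t) such that m₁ admits partial derivatives ∂_t m₁, ∂_x m₁, ∂_x² m₁ and m₂ admits the partial derivative ∂_x m₂ (entrywise). Suppose that at every point the two matrix identities hold: (E1) −iℏ ∂_x [m₁, σ₃] − [[m₂, σ₃], σ₃] + [[m₁, σ₃] m₁, σ₃] = 0, and (E2) iℏ ∂_t [m₁, σ₃] − iℏ ∂_x ([m₂, σ₃] − [m₁, σ₃] m₁) + [[m₁, σ₃], [m₂, σ₃]] − [[m₁, σ₃], [m₁, σ₃] m₁] = 0. Then the off-diagonal entries q := (m₁)₁₂ and r := (m₁)₂₁ satisfy, at every point, iℏ ∂_t q + (ℏ²/2) ∂_x² q − 4 r q² = 0 and −iℏ ∂_t r + (ℏ²/2) ∂_x² r − 4 q r² = 0. -/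
/-- The commutator `[X, Y] = XY − YX` of two `2 × 2` complex matrices. -/
noncomputable def matComm (X Y : Matrix (Fin 2) (Fin 2) ℂ) : Matrix (Fin 2) (Fin 2) ℂ := X * Y - Y * X

/-- The Pauli matrix `σ₃ = diag(1, −1)`. -/
noncomputable def sigma3 : Matrix (Fin 2) (Fin 2) ℂ := !![1, 0; 0, -1]

theorem matComm_sigma3 (X : Matrix (Fin 2) (Fin 2) ℂ) :
    matComm X sigma3 = !![0, -2 * X 0 1; 2 * X 1 0, 0] := by
  ext i j
  fin_cases i <;> fin_cases j <;>
    simp [matComm, sigma3, Matrix.mul_apply, Fin.sum_univ_two, -Matrix.cons_mul] <;> ring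

/-- **The coupled NLS system from the zero-curvature equations.**  If `m₁, m₂` are matrix
functions of `(x,t)` (with the indicated entrywise partial derivatives) satisfying the two
coefficient equations (E1) and (E2) of the zero-curvature compatibility condition, then the
off-diagonal entries `q = (m₁)₁₂`, `r = (m₁)₂₁` satisfy
`iℏ ∂_t q + (ℏ²/2) ∂_x² q − 4rq² = 0` and `−iℏ ∂_t r + (ℏ²/2) ∂_x² r − 4qr² = 0`. -/
theorem coupled_nls_from_zero_curvature (ℏ : ℝ) (hℏ : 0 < ℏ)
    (m₁ m₂ m1t m1x m1xx m2x : ℝ → ℝ → Matrix (Fin 2) (Fin 2) ℂ)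
    (hm1t : ∀ (i j : Fin 2) (x t : ℝ), HasDerivAt (fun s => m₁ x s i j) (m1t x t i j) t)
    (hm1x : ∀ (i j : Fin 2) (x t : ℝ), HasDerivAt (fun y => m₁ y t i j) (m1x x t i j) x)
    (hm1xx : ∀ (i j : Fin 2) (x t : ℝ), HasDerivAt (fun y => m1x y t i j) (m1xx x t i j) x)
    (hm2x : ∀ (i j : Fin 2) (x t : ℝ), HasDerivAt (fun y => m₂ y t i j) (m2x x t i j) x)
    (hE1 : ∀ x t : ℝ,
      (-(Complex.I * (ℏ : ℂ))) • matComm (m1x x t) sigma3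
        - matComm (matComm (m₂ x t) sigma3) sigma3
        + matComm (matComm (m₁ x t) sigma3 * m₁ x t) sigma3 = 0)
    (hE2 : ∀ x t : ℝ,
      (Complex.I * (ℏ : ℂ)) • matComm (m1t x t) sigma3
        - (Complex.I * (ℏ : ℂ)) •
            (matComm (m2x x t) sigma3
              - (matComm (m1x x t) sigma3 * m₁ x t + matComm (m₁ x t) sigma3 * m1x x t))
        + matComm (matComm (m₁ x t) sigma3) (matComm (m₂ x t) sigma3)
        - matComm (matComm (m₁ x t) sigma3) (matComm (m₁ x t) sigma3 * m₁ x t) = 0) :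
    ∀ x t : ℝ,
      (Complex.I * (ℏ : ℂ) * m1t x t 0 1 + (ℏ : ℂ) ^ 2 / 2 * m1xx x t 0 1
          - 4 * m₁ x t 1 0 * (m₁ x t 0 1) ^ 2 = 0) ∧
      (-(Complex.I * (ℏ : ℂ)) * m1t x t 1 0 + (ℏ : ℂ) ^ 2 / 2 * m1xx x t 1 0
          - 4 * m₁ x t 0 1 * (m₁ x t 1 0) ^ 2 = 0) := by
  have hB : ∀ x t, m₂ x t 0 1 = m₁ x t 0 1 * m₁ x t 1 1 + Complex.I * ℏ / 2 * m1x x t 0 1 := by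
    intro x t
    have h := congrFun₂ (hE1 x t) 0 1
    simp [matComm_sigma3, Matrix.mul_apply, Fin.sum_univ_two, -Matrix.cons_mul] at h
    linear_combination (-1 / 4) * h
  have hC : ∀ x t, m₂ x t 1 0 = m₁ x t 1 0 * m₁ x t 0 0 - Complex.I * ℏ / 2 * m1x x t 1 0 := by
    intro x t
    have h := congrFun₂ (hE1 x t) 1 0
    simp [matComm_sigma3, Matrix.mul_apply, Fin.sum_univ_two, -Matrix.cons_mul] at h
    linear_combination (-1 / 4) * h
  intro x t
  constructor
  · have hB' := (hm2x 0 1 x t).unique <|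
      (((hm1x 0 1 x t).mul (hm1x 1 1 x t)).add
        ((hm1xx 0 1 x t).const_mul (Complex.I * ℏ / 2))).congr_of_eventuallyEq
          (.of_forall fun y => hB y t)
    have h := congrFun₂ (hE2 x t) 0 1
    simp only [matComm_sigma3] at h
    simp [matComm, Matrix.mul_apply, Fin.sum_univ_two, -Matrix.cons_mul] at h
    linear_combination (-1 / 2) * h + Complex.I * ℏ * hB'
      + (ℏ : ℂ) ^ 2 / 2 * m1xx x t 0 1 * Complex.I_sq
  · have hC' := (hm2x 1 0 x t).unique <|
      (((hm1x 1 0 x t).mul (hm1x 0 0 x t)).sub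
        ((hm1xx 1 0 x t).const_mul (Complex.I * ℏ / 2))).congr_of_eventuallyEq
          (.of_forall fun y => hC y t)
    have h := congrFun₂ (hE2 x t) 1 0
    simp only [matComm_sigma3] at h
    simp [matComm, Matrix.mul_apply, Fin.sum_univ_two, -Matrix.cons_mul] at h
    linear_combination (-1 / 2) * h - Complex.I * ℏ * hC'
      + (ℏ : ℂ) ^ 2 / 2 * m1xx x t 1 0 * Complex.I_sq
end

section
/- Let A > 0 and δ > 0. For each integer N ≥ 1 and k ∈ {0, …, N−1} set b_{N,k} := (k + 1/2)·A/N. Then there exists a constant C > 0 such that for every integer N ≥ 1 and every λ ∈ ℂ with Re λ ≥ δ, | ∏_{k=0}^{N−1} (λ + i b_{N,k})/(λ − i b_{N,k}) · exp( −(N/A) ∫₀^A (Log(λ + is) − Log(λ − is)) ds ) − 1 | ≤ C/N, where Log denotes the principal branch of the complex logarithm. -/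
open Finset

/-- First-order Taylor estimate for a function whose derivative is `M`-Lipschitz. -/
lemma norm_sub_sub_smul_le_of_lipschitz_deriv {f f' : ℝ → ℂ} {M : ℝ}
    (hf : ∀ s, HasDerivAt f (f' s) s) (hL : ∀ x y, ‖f' x - f' y‖ ≤ M * |x - y|) (hM : 0 ≤ M)
    {c h s : ℝ} (hs : |s - c| ≤ h) :
    ‖f s - f c - (s - c) • f' c‖ ≤ M * h ^ 2 := by
  have h0 : 0 ≤ h := (abs_nonneg _).trans hs
  have hg : ∀ x ∈ Set.Icc (c - h) (c + h),
      HasDerivWithinAt (fun x => f x - x • f' c) (f' x - f' c) (Set.Icc (c - h) (c + h)) x := by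
    intro x _
    have := (hf x).sub ((hasDerivAt_id x).smul_const (f' c))
    rw [one_smul] at this
    exact this.hasDerivWithinAt
  have hb : ∀ x ∈ Set.Icc (c - h) (c + h), ‖f' x - f' c‖ ≤ M * h := by
    intro x hx
    refine (hL x c).trans (mul_le_mul_of_nonneg_left ?_ hM)
    rw [abs_le]
    constructor <;> linarith [hx.1, hx.2]
  have hs' := abs_le.1 hs
  have key := (convex_Icc (c - h) (c + h)).norm_image_sub_le_of_norm_hasDerivWithin_le hg hb
    (show c ∈ _ from ⟨by linarith, by linarith⟩)
    (show s ∈ _ from ⟨by linarith, by linarith⟩)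
  calc ‖f s - f c - (s - c) • f' c‖ = ‖f s - s • f' c - (f c - c • f' c)‖ := by
        congr 1
        rw [sub_smul]
        abel
    _ ≤ M * h * ‖s - c‖ := key
    _ ≤ M * h * h := by
        rw [Real.norm_eq_abs]
        gcongr
    _ = M * h ^ 2 := by ring

/-- Midpoint rule on a single interval of half-width `h` centred at `c`. -/
lemma norm_integral_sub_midpoint_le {f f' : ℝ → ℂ} {M : ℝ}
    (hf : ∀ s, HasDerivAt f (f' s) s) (hL : ∀ x y, ‖f' x - f' y‖ ≤ M * |x - y|) (hM : 0 ≤ M)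
    (c : ℝ) {h : ℝ} (hh : 0 ≤ h) :
    ‖(∫ s in (c - h)..(c + h), f s) - (2 * h) • f c‖ ≤ 2 * M * h ^ 3 := by
  have hcont : Continuous f := continuous_iff_continuousAt.2 fun s => (hf s).continuousAt
  have hlin : ∫ s in (c - h)..(c + h), (s - c) • f' c = 0 := by
    rw [intervalIntegral.integral_smul_const, intervalIntegral.integral_sub
      (by simp) (by simp), integral_id, intervalIntegral.integral_const]
    have : ((c + h) ^ 2 - (c - h) ^ 2) / 2 - (c + h - (c - h)) • c = 0 := by
      rw [smul_eq_mul]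
      ring
    rw [this, zero_smul]
  have heq : (∫ s in (c - h)..(c + h), f s) - (2 * h) • f c
      = ∫ s in (c - h)..(c + h), (f s - f c - (s - c) • f' c) := by
    rw [intervalIntegral.integral_sub, hlin, intervalIntegral.integral_sub,
      intervalIntegral.integral_const, sub_zero]
    · congr 2
      ring
    all_goals exact Continuous.intervalIntegrable (by fun_prop) _ _
  rw [heq]
  have hbound : ∀ s ∈ Set.uIoc (c - h) (c + h),
      ‖f s - f c - (s - c) • f' c‖ ≤ M * h ^ 2 := by
    intro s hs
    rw [Set.uIoc_of_le (by linarith)] at hs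
    refine norm_sub_sub_smul_le_of_lipschitz_deriv hf hL hM ?_
    rw [abs_le]
    constructor <;> linarith [hs.1, hs.2]
  refine (intervalIntegral.norm_integral_le_of_norm_le_const hbound).trans_eq ?_
  rw [show c + h - (c - h) = 2 * h by ring, abs_of_nonneg (by linarith)]
  ring

/-- Composite midpoint rule on `[0, A]` with `N` cells. -/
lemma norm_integral_sub_sum_midpoint_le {f f' : ℝ → ℂ} {M : ℝ}
    (hf : ∀ s, HasDerivAt f (f' s) s) (hL : ∀ x y, ‖f' x - f' y‖ ≤ M * |x - y|) (hM : 0 ≤ M)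
    {A : ℝ} (hA : 0 ≤ A) {N : ℕ} (hN : 1 ≤ N) :
    ‖(∫ s in (0 : ℝ)..A, f s) - ∑ k ∈ range N, (A / N) • f (((k : ℝ) + 1 / 2) * A / N)‖
      ≤ M * A ^ 3 / (4 * N ^ 2) := by
  have hcont : Continuous f := continuous_iff_continuousAt.2 fun s => (hf s).continuousAt
  have hN0 : (0 : ℝ) < N := by exact_mod_cast hN
  have hsum := intervalIntegral.sum_integral_adjacent_intervals (f := f)
    (μ := MeasureTheory.volume) (a := fun k : ℕ => (k : ℝ) * A / N) (n := N)
    fun k _ => hcont.intervalIntegrable _ _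
  have hend : (N : ℝ) * A / N = A := by field_simp
  simp only [Nat.cast_zero, zero_mul, zero_div, hend] at hsum
  rw [← hsum, ← sum_sub_distrib]
  have hcell : ∀ k ∈ range N,
      ‖(∫ s in ((k : ℝ) * A / N)..(((k + 1 : ℕ) : ℝ) * A / N), f s)
        - (A / N) • f (((k : ℝ) + 1 / 2) * A / N)‖ ≤ 2 * M * (A / (2 * N)) ^ 3 := by
    intro k _
    have key := norm_integral_sub_midpoint_le hf hL hM (((k : ℝ) + 1 / 2) * A / N)
      (h := A / (2 * N)) (by positivity)
    have e1 : ((k : ℝ) + 1 / 2) * A / N - A / (2 * N) = k * A / N := by field_simp; ring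
    have e2 : ((k : ℝ) + 1 / 2) * A / N + A / (2 * N) = ((k + 1 : ℕ) : ℝ) * A / N := by
      push_cast
      field_simp
      ring
    have e3 : 2 * (A / (2 * N)) = A / N := by field_simp
    rwa [e1, e2, e3] at key
  refine (norm_sum_le_of_le _ hcell).trans_eq ?_
  rw [sum_const, card_range, nsmul_eq_mul]
  field_simp
  ring

lemma re_add_I_mul_ofReal (z : ℂ) (s : ℝ) : (z + Complex.I * s).re = z.re := by simp

lemma re_sub_I_mul_ofReal (z : ℂ) (s : ℝ) : (z - Complex.I * s).re = z.re := by simp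

/-- The integrand `Log (z + is) - Log (z - is)` is differentiable in `s` when `0 < Re z`. -/
lemma hasDerivAt_log_add_sub_log_sub {z : ℂ} (hz : 0 < z.re) (s : ℝ) :
    HasDerivAt (fun s : ℝ => Complex.log (z + Complex.I * s) - Complex.log (z - Complex.I * s))
      (Complex.I / (z + Complex.I * s) + Complex.I / (z - Complex.I * s)) s := by
  have hI : HasDerivAt (fun s : ℝ => Complex.I * (s : ℂ)) Complex.I s := by
    simpa using (Complex.ofRealCLM.hasDerivAt (x := s)).const_mul Complex.I
  have h1 := (hI.const_add z).clog_real (Or.inl (by rwa [re_add_I_mul_ofReal]))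
  have h2 := (hI.const_sub z).clog_real (Or.inl (by rwa [re_sub_I_mul_ofReal]))
  exact (h1.sub h2).congr_deriv (by rw [neg_div, sub_neg_eq_add])

lemma norm_I_div_sub_I_div_le {δ : ℝ} (hδ : 0 < δ) {u v : ℂ} (hu : δ ≤ u.re) (hv : δ ≤ v.re) :
    ‖Complex.I / u - Complex.I / v‖ ≤ ‖v - u‖ / δ ^ 2 := by
  have hu' : δ ≤ ‖u‖ := hu.trans (Complex.re_le_norm u)
  have hv' : δ ≤ ‖v‖ := hv.trans (Complex.re_le_norm v)
  have hu0 : u ≠ 0 := norm_pos_iff.1 (hδ.trans_le hu')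
  have hv0 : v ≠ 0 := norm_pos_iff.1 (hδ.trans_le hv')
  have : Complex.I / u - Complex.I / v = Complex.I * (v - u) / (u * v) := by
    field_simp
  rw [this, norm_div, norm_mul, norm_mul, Complex.norm_I, one_mul, sq]
  gcongr

lemma norm_deriv_log_add_sub_log_sub_sub_le {δ : ℝ} (hδ : 0 < δ) {z : ℂ} (hz : δ ≤ z.re)
    (x y : ℝ) :
    ‖(Complex.I / (z + Complex.I * x) + Complex.I / (z - Complex.I * x))
      - (Complex.I / (z + Complex.I * y) + Complex.I / (z - Complex.I * y))‖
      ≤ 2 / δ ^ 2 * |x - y| := by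
  have h1 := norm_I_div_sub_I_div_le hδ (u := z + Complex.I * x) (v := z + Complex.I * y)
    (by rwa [re_add_I_mul_ofReal]) (by rwa [re_add_I_mul_ofReal])
  have h2 := norm_I_div_sub_I_div_le hδ (u := z - Complex.I * x) (v := z - Complex.I * y)
    (by rwa [re_sub_I_mul_ofReal]) (by rwa [re_sub_I_mul_ofReal])
  have hn : ‖Complex.I * ((x - y : ℝ) : ℂ)‖ = |x - y| := by
    rw [norm_mul, Complex.norm_I, one_mul, Complex.norm_real, Real.norm_eq_abs]
  have n1 : ‖z + Complex.I * y - (z + Complex.I * x)‖ = |x - y| := by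
    rw [← hn, ← norm_neg]
    congr 1
    push_cast
    ring
  have n2 : ‖z - Complex.I * y - (z - Complex.I * x)‖ = |x - y| := by
    rw [← hn]
    congr 1
    push_cast
    ring
  rw [n1] at h1
  rw [n2] at h2
  rw [add_sub_add_comm]
  refine (norm_add_le_of_le h1 h2).trans_eq ?_
  ring



/-- **Midpoint-rule estimate for the condensed-pole approximation.**  For `A > 0` and
`δ > 0`, with `b_{N,k} = (k + 1/2)A/N`, there is a constant `C > 0` such that for all
`N ≥ 1` and all `λ` with `Re λ ≥ δ`,
`| ∏ₖ (λ + i b_{N,k})/(λ − i b_{N,k}) · exp(−(N/A) ∫₀^A (Log(λ+is) − Log(λ−is)) ds) − 1 |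
  ≤ C/N`, i.e. the ratio `S(λ)` of the Blaschke-type product to its formal continuum
limit is `1 + O(1/N)` uniformly on the half-plane `Re λ ≥ δ`. -/
theorem blaschke_product_continuum_limit (A δ : ℝ) (hA : 0 < A) (hδ : 0 < δ) :
    ∃ C : ℝ, 0 < C ∧ ∀ N : ℕ, 1 ≤ N → ∀ z : ℂ, δ ≤ z.re →
      ‖(∏ k ∈ Finset.range N,
            (z + Complex.I * ((((k : ℝ) + 1/2) * A / N : ℝ) : ℂ)) /
              (z - Complex.I * ((((k : ℝ) + 1/2) * A / N : ℝ) : ℂ))) *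
          Complex.exp (-((N : ℂ) / (A : ℂ)) *
            ∫ s in (0:ℝ)..A, (Complex.log (z + Complex.I * (s : ℂ))
              - Complex.log (z - Complex.I * (s : ℂ)))) - 1‖ ≤ C / N := by
  set K : ℝ := A ^ 2 / (2 * δ ^ 2) with hK
  have hK0 : 0 < K := by positivity
  refine ⟨K * Real.exp K, by positivity, fun N hN z hz => ?_⟩
  have hz0 : 0 < z.re := hδ.trans_le hz
  have hN1 : (1 : ℝ) ≤ N := by exact_mod_cast hN
  have hN0 : (0 : ℝ) < N := by linarith
  have hNC : (N : ℂ) ≠ 0 := by exact_mod_cast hN0.ne'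
  have hAC : (A : ℂ) ≠ 0 := by exact_mod_cast hA.ne'
  set f : ℝ → ℂ := fun s =>
    Complex.log (z + Complex.I * (s : ℂ)) - Complex.log (z - Complex.I * (s : ℂ)) with hf
  have hmid := norm_integral_sub_sum_midpoint_le (hasDerivAt_log_add_sub_log_sub hz0)
    (norm_deriv_log_add_sub_log_sub_sub_le hδ hz) (by positivity) hA.le hN
  have hexp : ∀ s : ℝ, (z + Complex.I * (s : ℂ)) / (z - Complex.I * (s : ℂ))
      = Complex.exp (f s) := by
    intro s
    have h1 : z + Complex.I * (s : ℂ) ≠ 0 := fun h => by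
      have := re_add_I_mul_ofReal z s
      rw [h, Complex.zero_re] at this
      linarith
    have h2 : z - Complex.I * (s : ℂ) ≠ 0 := fun h => by
      have := re_sub_I_mul_ofReal z s
      rw [h, Complex.zero_re] at this
      linarith
    rw [hf, Complex.exp_sub, Complex.exp_log h1, Complex.exp_log h2]
  rw [prod_congr rfl fun k _ => hexp _, ← Complex.exp_sum, ← Complex.exp_add]
  set D : ℂ := (∫ s in (0 : ℝ)..A, f s)
    - ∑ k ∈ range N, (A / N : ℝ) • f (((k : ℝ) + 1 / 2) * A / N) with hD
  have hE : ∑ k ∈ range N, f (((k : ℝ) + 1 / 2) * A / N)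
      + -((N : ℂ) / (A : ℂ)) * ∫ s in (0 : ℝ)..A, f s = -((N : ℂ) / (A : ℂ)) * D := by
    rw [hD, ← smul_sum, Complex.real_smul]
    generalize ∑ k ∈ range N, f (((k : ℝ) + 1 / 2) * A / N) = S
    push_cast
    field_simp
    ring
  rw [hE]
  have hEb : ‖-((N : ℂ) / (A : ℂ)) * D‖ ≤ K / N := by
    rw [norm_mul, norm_neg, norm_div, Complex.norm_natCast, Complex.norm_real,
      Real.norm_of_nonneg hA.le]
    calc (N : ℝ) / A * ‖D‖ ≤ N / A * (2 / δ ^ 2 * A ^ 3 / (4 * N ^ 2)) := by gcongr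
      _ = K / N := by
        rw [hK]
        field_simp
        ring
  have hEK : ‖-((N : ℂ) / (A : ℂ)) * D‖ ≤ K := hEb.trans (div_le_self hK0.le hN1)
  have hexp1 := Complex.norm_exp_sub_sum_le_norm_mul_exp (-((N : ℂ) / (A : ℂ)) * D) 1
  simp only [sum_range_one, pow_zero, Nat.factorial_zero, Nat.cast_one, div_one, pow_one]
    at hexp1
  calc _ ≤ _ := hexp1
    _ ≤ K / N * Real.exp K := by gcongr
    _ = K * Real.exp K / N := by ring
end

section
/- Let N ≥ 1, let λ_0, …, λ_{N−1} be distinct complex numbers in the open upper half-plane, and let c_0, …, c_{N−1} ∈ ℂ. Let A_0, …, A_{N−1} and B_0, …, B_{N−1} be 2×2 complex matrices, and define, for λ distinct from all λ_k and λ_k^*, n(λ) := I + ∑_{k=0}^{N−1} (λ − λ_k)^{−1} A_k + ∑_{k=0}^{N−1} (λ − λ_k^*)^{−1} B_k. Let E₂₁ be the matrix with (2,1) entry 1 and all other entries 0, and E₁₂ the matrix with (1,2) entry 1 and all other entries 0. Suppose that for each k the residue conditions hold: A_k = n_k(λ_k) · (c_k E₂₁), where n_k(λ) := n(λ) − (λ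 − λ_k)^{−1} A_k (so n_k extends to λ_k), and B_k = ñ_k(λ_k^*) · (−c_k^* E₁₂), where ñ_k(λ) := n(λ) − (λ − λ_k^*)^{−1} B_k. Then det n(λ) = 1 for every λ ∈ ℂ distinct from all λ_k and λ_k^*. -/
open Finset

/-- The columns `f(z) = e₁ + ∑ⱼ (z - μⱼ)⁻¹ aⱼ` and `g(z) = e₂ + ∑ₖ (z - νₖ)⁻¹ bₖ` have
determinant `1` away from the poles when each `aⱼ` is parallel to `g(μⱼ)` and each `bₖ` is
parallel to `f(νₖ)`. -/
theorem det_columns_eq_one_of_residues {K ι κ : Type*} [Field K] [Fintype ι] [Fintype κ]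
    (μ : ι → K) (ν : κ → K) (hne : ∀ j k, μ j ≠ ν k) (c : ι → K) (d : κ → K)
    (a₀ a₁ : ι → K) (b₀ b₁ : κ → K)
    (ha₀ : ∀ j, a₀ j = c j * ∑ k, (μ j - ν k)⁻¹ * b₀ k)
    (ha₁ : ∀ j, a₁ j = c j * (1 + ∑ k, (μ j - ν k)⁻¹ * b₁ k))
    (hb₀ : ∀ k, b₀ k = d k * (1 + ∑ j, (ν k - μ j)⁻¹ * a₀ j))
    (hb₁ : ∀ k, b₁ k = d k * ∑ j, (ν k - μ j)⁻¹ * a₁ j)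
    (z : K) (hzμ : ∀ j, z ≠ μ j) (hzν : ∀ k, z ≠ ν k) :
    (1 + ∑ j, (z - μ j)⁻¹ * a₀ j) * (1 + ∑ k, (z - ν k)⁻¹ * b₁ k)
      - (∑ k, (z - ν k)⁻¹ * b₀ k) * (∑ j, (z - μ j)⁻¹ * a₁ j) = 1 := by
  have hμ_sum : ∑ j, (z - μ j)⁻¹ * (a₀ j * (1 + ∑ k, (μ j - ν k)⁻¹ * b₁ k)
      - a₁ j * ∑ k, (μ j - ν k)⁻¹ * b₀ k) = 0 :=
    Finset.sum_eq_zero fun j _ => by rw [ha₀, ha₁]; ring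
  have hν_sum : ∑ k, (z - ν k)⁻¹ * ((1 + ∑ j, (ν k - μ j)⁻¹ * a₀ j) * b₁ k
      - (∑ j, (ν k - μ j)⁻¹ * a₁ j) * b₀ k) = 0 :=
    Finset.sum_eq_zero fun k _ => by rw [hb₀, hb₁]; ring
  have hprod : (∑ j, (z - μ j)⁻¹ * a₀ j) * (∑ k, (z - ν k)⁻¹ * b₁ k)
      - (∑ j, (z - μ j)⁻¹ * a₁ j) * (∑ k, (z - ν k)⁻¹ * b₀ k)
      = ∑ j, ∑ k, (z - μ j)⁻¹ * (a₀ j * ((μ j - ν k)⁻¹ * b₁ k)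
          - a₁ j * ((μ j - ν k)⁻¹ * b₀ k))
        + ∑ j, ∑ k, (z - ν k)⁻¹ * ((ν k - μ j)⁻¹ * a₀ j * b₁ k
          - (ν k - μ j)⁻¹ * a₁ j * b₀ k) := by
    simp only [Finset.sum_mul_sum, ← Finset.sum_sub_distrib, ← Finset.sum_add_distrib]
    refine Finset.sum_congr rfl fun j _ => Finset.sum_congr rfl fun k _ => ?_
    have h₁ := sub_ne_zero.2 (hzμ j)
    have h₂ := sub_ne_zero.2 (hzν k)
    have h₃ := sub_ne_zero.2 (hne j k)
    rw [← neg_sub (μ j) (ν k), inv_neg]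
    field_simp
    ring
  have hμ_split : ∑ j, (z - μ j)⁻¹ * (a₀ j * (1 + ∑ k, (μ j - ν k)⁻¹ * b₁ k)
      - a₁ j * ∑ k, (μ j - ν k)⁻¹ * b₀ k)
      = ∑ j, (z - μ j)⁻¹ * a₀ j + ∑ j, ∑ k, (z - μ j)⁻¹ * (a₀ j * ((μ j - ν k)⁻¹ * b₁ k)
          - a₁ j * ((μ j - ν k)⁻¹ * b₀ k)) := by
    rw [← Finset.sum_add_distrib]
    refine Finset.sum_congr rfl fun j _ => ?_
    rw [← Finset.mul_sum, Finset.sum_sub_distrib, ← Finset.mul_sum, ← Finset.mul_sum]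
    ring
  have hν_split : ∑ k, (z - ν k)⁻¹ * ((1 + ∑ j, (ν k - μ j)⁻¹ * a₀ j) * b₁ k
      - (∑ j, (ν k - μ j)⁻¹ * a₁ j) * b₀ k)
      = ∑ k, (z - ν k)⁻¹ * b₁ k + ∑ j, ∑ k, (z - ν k)⁻¹ * ((ν k - μ j)⁻¹ * a₀ j * b₁ k
          - (ν k - μ j)⁻¹ * a₁ j * b₀ k) := by
    rw [Finset.sum_comm (s := Finset.univ (α := ι)), ← Finset.sum_add_distrib]
    refine Finset.sum_congr rfl fun k _ => ?_
    rw [← Finset.mul_sum, Finset.sum_sub_distrib, ← Finset.sum_mul, ← Finset.sum_mul]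
    ring
  linear_combination hprod - hμ_split - hν_split + hμ_sum + hν_sum

/-- **Unimodularity of the solution of the discrete Riemann–Hilbert problem.**
Let `μ 0, …, μ (N−1)` be distinct points of the open upper half-plane, and let
`n(λ) = I + ∑ₖ (λ − μₖ)⁻¹ Aₖ + ∑ₖ (λ − μₖ*)⁻¹ Bₖ` be a rational `2×2` matrix function
whose residues satisfy `Aₖ = nₖ(μₖ)·(cₖ E₂₁)` and `Bₖ = ñₖ(μₖ*)·(−cₖ* E₁₂)`, where
`nₖ(λ) := n(λ) − (λ − μₖ)⁻¹ Aₖ` and `ñₖ(λ) := n(λ) − (λ − μₖ*)⁻¹ Bₖ` are the regular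
parts.  Then `det n(λ) = 1` for every `λ` distinct from all the `μₖ` and `μₖ*`. -/
theorem det_discrete_RHP_eq_one (N : ℕ) (hN : 1 ≤ N) (μ : Fin N → ℂ)
    (hμ : Function.Injective μ) (him : ∀ k, 0 < (μ k).im) (c : Fin N → ℂ)
    (Amat Bmat : Fin N → Matrix (Fin 2) (Fin 2) ℂ)
    (n : ℂ → Matrix (Fin 2) (Fin 2) ℂ)
    (hn : ∀ z : ℂ, n z = 1 + (∑ k : Fin N, (z - μ k)⁻¹ • Amat k)
        + ∑ k : Fin N, (z - starRingEnd ℂ (μ k))⁻¹ • Bmat k)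
    (nreg ntreg : Fin N → ℂ → Matrix (Fin 2) (Fin 2) ℂ)
    (hnreg : ∀ (k : Fin N) (z : ℂ), nreg k z = n z - (z - μ k)⁻¹ • Amat k)
    (hntreg : ∀ (k : Fin N) (z : ℂ),
      ntreg k z = n z - (z - starRingEnd ℂ (μ k))⁻¹ • Bmat k)
    (hres1 : ∀ k : Fin N,
      Amat k = nreg k (μ k) * (c k • (!![0, 0; 1, 0] : Matrix (Fin 2) (Fin 2) ℂ)))
    (hres2 : ∀ k : Fin N,
      Bmat k = ntreg k (starRingEnd ℂ (μ k)) *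
        ((-(starRingEnd ℂ (c k))) • (!![0, 1; 0, 0] : Matrix (Fin 2) (Fin 2) ℂ))) :
    ∀ z : ℂ, (∀ k : Fin N, z ≠ μ k ∧ z ≠ starRingEnd ℂ (μ k)) → (n z).det = 1 := by
  have hne : ∀ j k, μ j ≠ starRingEnd ℂ (μ k) := fun j k h => by
    have h_im := congrArg Complex.im h
    rw [Complex.conj_im] at h_im
    linarith [him j, him k]
  have hA : ∀ k i, Amat k i 1 = 0 := fun k i => by
    rw [hres1 k]; fin_cases i <;> simp [Matrix.mul_apply]
  have hB : ∀ k i, Bmat k i 0 = 0 := fun k i => by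
    rw [hres2 k]; fin_cases i <;> simp [Matrix.mul_apply]
  have hA' : ∀ k i, Amat k i 0 = c k * n (μ k) i 1 := fun k i => by
    conv_lhs => rw [hres1 k, hnreg]
    simp [Matrix.mul_apply, mul_comm]
  have hB' : ∀ k i, Bmat k i 1 = -(starRingEnd ℂ (c k)) * n (starRingEnd ℂ (μ k)) i 0 :=
    fun k i => by
      conv_lhs => rw [hres2 k, hntreg]
      simp [Matrix.mul_apply, mul_comm]
  have hn₀ : ∀ z i, n z i 0 = (1 : Matrix (Fin 2) (Fin 2) ℂ) i 0
      + ∑ k, (z - μ k)⁻¹ * Amat k i 0 := fun z i => by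
    simp [hn, Matrix.sum_apply, hB]
  have hn₁ : ∀ z i, n z i 1 = (1 : Matrix (Fin 2) (Fin 2) ℂ) i 1
      + ∑ k, (z - starRingEnd ℂ (μ k))⁻¹ * Bmat k i 1 := fun z i => by
    simp [hn, Matrix.sum_apply, hA]
  intro z hz
  have key := det_columns_eq_one_of_residues μ (fun k => starRingEnd ℂ (μ k)) hne c
    (fun k => -(starRingEnd ℂ (c k))) (fun k => Amat k 0 0) (fun k => Amat k 1 0)
    (fun k => Bmat k 0 1) (fun k => Bmat k 1 1)
    (fun j => by simp [hA', hn₁ (μ j)]) (fun j => by simp [hA', hn₁ (μ j)])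
    (fun k => by simp [hB', hn₀ (starRingEnd ℂ (μ k))])
    (fun k => by simp [hB', hn₀ (starRingEnd ℂ (μ k))])
    z (fun j => (hz j).1) (fun k => (hz k).2)
  rw [Matrix.det_fin_two, hn₀, hn₀, hn₁, hn₁]
  simpa using key
end
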